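/- Let α₁, …, αₙ be real numbers, each of which is of the form p_i(π) for some polynomial p_i with rational coefficients, and suppose not all α_i are zero. Let x₁, …, xₙ be real algebraic numbers that are linearly independent over ℚ. Then α₁x₁ + ⋯ + αₙxₙ ≠ 0. -/

import Mathlib

open Polynomial in
theorem Complex.exists_intPoly_eval_zero_ne_zero_of_isAlgebraic {ι : Type*} (s : Finset ι)
    (β : ι → ℂ) (hβ : ∀ i ∈ s, IsAlgebraic ℤ (β i)) (hβ0 : ∀ i ∈ s, β i ≠ 0) :
    ∃ f : ℤ[X], f.eval 0 ≠ 0 ∧ ∀ i ∈ s, aeval (β i) f = 0 := by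
  have h : ∀ i ∈ s, ∃ f : ℤ[X], f.coeff 0 ≠ 0 ∧ aeval (β i) f = 0 := fun i hi =>
    (hβ i hi).exists_nonzero_coeff_and_aeval_eq_zero (mem_nonZeroDivisors_of_ne_zero (hβ0 i hi))
  choose! f hf0 hf using h
  refine ⟨∏ i ∈ s, f i, ?_, fun i hi => ?_⟩
  · rw [eval_prod]
    exact Finset.prod_ne_zero_iff.mpr fun i hi => by
      rw [← coeff_zero_eq_eval_zero]; exact hf0 i hi
  · rw [map_prod]
    exact Finset.prod_eq_zero hi (hf i hi)

theorem Real.exists_forall_ge_mul_pow_div_factorial_pred_lt_one (A C : ℝ) :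
    ∃ N : ℕ, ∀ p ≥ N, A * (C ^ p / ((p - 1).factorial : ℝ)) < 1 := by
  have h := (FloorSemiring.tendsto_pow_div_factorial_atTop C).const_mul (A * C)
  rw [mul_zero] at h
  obtain ⟨N, hN⟩ := Filter.eventually_atTop.mp (h.eventually_lt_const one_pos)
  refine ⟨N + 1, fun p hp => ?_⟩
  obtain ⟨q, rfl⟩ : ∃ q, p = q + 1 := ⟨p - 1, by omega⟩
  have := hN q (by omega)
  rw [Nat.add_sub_cancel, pow_succ]
  calc _ = A * C * (C ^ q / (q.factorial : ℝ)) := by ring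
    _ < 1 := this

open Polynomial in
/-- A weak form of the Lindemann–Weierstrass theorem, for a family `β` whose polynomial power
sums become integers after clearing the denominator `a`. -/
theorem Complex.natCast_add_sum_exp_ne_zero {ι : Type*} (s : Finset ι) (β : ι → ℂ)
    (hβ : ∀ i ∈ s, IsAlgebraic ℤ (β i)) (hβ0 : ∀ i ∈ s, β i ≠ 0) (a : ℤ) (ha : a ≠ 0)
    (hint : ∀ (g : ℤ[X]) (N : ℕ), g.natDegree ≤ N →
      ∃ z : ℤ, (a : ℂ) ^ N * ∑ i ∈ s, aeval (β i) g = z)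
    (k : ℕ) (hk : k ≠ 0) : (k : ℂ) + ∑ i ∈ s, exp (β i) ≠ 0 := by
  intro hsum
  obtain ⟨f, hf0, hf⟩ := exists_intPoly_eval_zero_ne_zero_of_isAlgebraic s β hβ hβ0
  have hfne : f ≠ 0 := by rintro rfl; simp at hf0
  obtain ⟨c, hc⟩ := LindemannWeierstrass.exp_polynomial_approx f hf0
  set d := f.natDegree
  obtain ⟨N, hN⟩ := Real.exists_forall_ge_mul_pow_div_factorial_pred_lt_one
    (s.card : ℝ) (|(a : ℝ)| ^ d * |c|)
  obtain ⟨p, hp, hprime⟩ := Nat.exists_infinite_primes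
    (N + (f.eval 0).natAbs + a.natAbs + k + 1)
  obtain ⟨n, hpn, g, hg, happrox⟩ := hc p (by omega) hprime
  obtain ⟨z, hz⟩ := hint g (p * d) (hg.trans (Nat.sub_le _ _))
  have hpZ : Prime (p : ℤ) := Nat.prime_iff_prime_int.mp hprime
  have hpa : ¬ (p : ℤ) ∣ a := fun h => by
    have := Nat.le_of_dvd (Int.natAbs_pos.mpr ha) (Int.natCast_dvd.mp h)
    omega
  have hpk : ¬ (p : ℤ) ∣ k := fun h => by
    have := Nat.le_of_dvd (Nat.pos_of_ne_zero hk) (Int.natCast_dvd_natCast.mp h)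
    omega
  set M : ℤ := a ^ (p * d) * (n * k) + p * z with hM
  have hM0 : M ≠ 0 := fun h => by
    have h1 : (p : ℤ) ∣ a ^ (p * d) * (n * k) :=
      (dvd_add_left (dvd_mul_right _ _)).mp (h ▸ dvd_zero _ : (p : ℤ) ∣ M)
    rcases hpZ.dvd_or_dvd h1 with h2 | h2
    · exact hpa (hpZ.dvd_of_dvd_pow h2)
    · exact (hpZ.dvd_or_dvd h2).elim hpn hpk
  have hMeq : (M : ℂ) =
      -((a : ℂ) ^ (p * d) * ∑ i ∈ s, (n • exp (β i) - p • aeval (β i) g)) := by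
    have hk' : (k : ℂ) = -∑ i ∈ s, exp (β i) := eq_neg_of_add_eq_zero_left hsum
    simp only [zsmul_eq_mul, nsmul_eq_mul, Finset.sum_sub_distrib, ← Finset.mul_sum]
    rw [hM]
    push_cast
    rw [← hz, hk']
    ring
  have hbound : ‖(M : ℂ)‖ ≤
      s.card * ((|(a : ℝ)| ^ d * |c|) ^ p / ((p - 1).factorial : ℝ)) := by
    rw [hMeq, norm_neg, norm_mul, norm_pow, Complex.norm_intCast]
    calc _ ≤ |(a : ℝ)| ^ (p * d) * ∑ i ∈ s, |c| ^ p / ((p - 1).factorial : ℝ) := by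
          gcongr
          refine (norm_sum_le _ _).trans (Finset.sum_le_sum fun i hi => ?_)
          refine (happrox (mem_aroots.mpr ⟨hfne, hf i hi⟩)).trans ?_
          gcongr ?_ / _
          exact (le_abs_self _).trans (abs_pow c p).le
      _ = _ := by
          rw [Finset.sum_const, nsmul_eq_mul, mul_pow, ← pow_mul, mul_comm d p]
          ring
  have hlt := hbound.trans_lt (hN p (by omega))
  rw [Complex.norm_intCast] at hlt
  exact hM0 (Int.abs_lt_one_iff.mp (by exact_mod_cast hlt))

open Polynomial in
theorem IsIntegral.intCast_pow_mul_aeval {K : Type*} [Field K] {a : ℤ} {x : K}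
    (h : IsIntegral ℤ ((a : K) * x)) {g : ℤ[X]} {N : ℕ} (hg : g.natDegree ≤ N) :
    IsIntegral ℤ ((a : K) ^ N * aeval x g) := by
  rw [aeval_eq_sum_range' (Nat.lt_succ_of_le hg), Finset.mul_sum]
  refine IsIntegral.sum _ fun i hi => ?_
  obtain ⟨j, rfl⟩ := Nat.exists_eq_add_of_le (Nat.lt_succ_iff.mp (Finset.mem_range.mp hi))
  have : (a : K) ^ (i + j) * g.coeff i • x ^ i =
      ((a ^ j * g.coeff i : ℤ) : K) * ((a : K) * x) ^ i := by
    rw [zsmul_eq_mul]; push_cast; ring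
  rw [this]
  exact (isIntegral_algebraMap (R := ℤ) (x := a ^ j * g.coeff i)).mul (h.pow i)

theorem IsGalois.exists_intCast_eq_of_isIntegral_of_fixed {K : Type*} [Field K] [Algebra ℚ K]
    [FiniteDimensional ℚ K] [IsGalois ℚ K] {x : K} (hx : IsIntegral ℤ x)
    (hfix : ∀ σ : K ≃ₐ[ℚ] K, σ x = x) : ∃ z : ℤ, x = z := by
  obtain ⟨q, rfl⟩ := (IsGalois.mem_range_algebraMap_iff_fixed x).mpr hfix
  have hq : IsIntegral ℤ q :=
    (isIntegral_algebraMap_iff (algebraMap ℚ K).injective).mp hx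
  obtain ⟨z, rfl⟩ := IsIntegrallyClosed.isIntegral_iff.mp hq
  exact ⟨z, by simp⟩

open Polynomial in
theorem IsGalois.exp_algHom_ne_neg_one {K : Type*} [Field K] [Algebra ℚ K]
    [FiniteDimensional ℚ K] [IsGalois ℚ K] (φ : K →ₐ[ℚ] ℂ) (t : K) :
    Complex.exp (φ t) ≠ -1 := by
  classical
  intro hexp
  let G := K ≃ₐ[ℚ] K
  let b : Finset G → K := fun S => ∑ σ ∈ S, σ t
  have hb : ∀ (τ : G) (S : Finset G), τ (b S) = b ((Equiv.mulLeft τ).finsetCongr S) := by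
    intro τ S
    simp only [b, map_sum, Equiv.finsetCongr_apply, Finset.sum_map]
    rfl
  have halg : ∀ x : K, IsAlgebraic ℤ x := fun x =>
    (IsFractionRing.isAlgebraic_iff ℤ ℚ K).mpr (Algebra.IsAlgebraic.isAlgebraic x)
  obtain ⟨a, ha, hat⟩ := (halg t).exists_integral_multiple
  have hab : ∀ S, IsIntegral ℤ ((a : K) * b S) := by
    intro S
    rw [Finset.mul_sum]
    refine IsIntegral.sum _ fun σ _ => ?_
    have := hat.map (σ : K →ₐ[ℚ] K)
    simpa [zsmul_eq_mul] using this
  let s : Finset (Finset G) := Finset.univ.filter fun S => b S ≠ 0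
  let k : ℕ := (Finset.univ.filter fun S => ¬ b S ≠ 0).card
  have hk : k ≠ 0 := Finset.card_ne_zero_of_mem (a := ∅) (by simp [b])
  refine Complex.natCast_add_sum_exp_ne_zero s (fun S => φ (b S)) (fun S _ => ?_)
    (fun S hS => ?_) a ha
    (fun g N hg => ?_) k hk ?_
  · exact (halg (b S)).algHom (φ.restrictScalars ℤ)
  · simpa using (Finset.mem_filter.mp hS).2
  · obtain ⟨z, hz⟩ := IsGalois.exists_intCast_eq_of_isIntegral_of_fixed
      (x := (a : K) ^ N * ∑ S ∈ s, aeval (b S) g) (by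
        rw [Finset.mul_sum]
        exact IsIntegral.sum _ fun S _ => (hab S).intCast_pow_mul_aeval hg) (by
        intro τ
        rw [map_mul, map_pow, map_intCast, map_sum]
        congr 1
        refine Finset.sum_equiv (Equiv.mulLeft τ).finsetCongr (fun S => ?_) (fun S _ => ?_)
        · simp only [s, Finset.mem_filter, Finset.mem_univ, true_and, ← hb, ne_eq,
            map_eq_zero]
        · rw [← hb]
          exact (aeval_algHom_apply ((τ : K →ₐ[ℚ] K).restrictScalars ℤ) (b S) g).symm)
    refine ⟨z, ?_⟩
    have := congrArg φ hz
    rw [map_mul, map_pow, map_intCast, map_intCast, map_sum] at this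
    rw [← this]
    congr 1
    exact Finset.sum_congr rfl fun S _ =>
      aeval_algHom_apply (φ.restrictScalars ℤ) (b S) g
  · have hprod : ∏ σ : G, (1 + Complex.exp (φ (σ t))) = 0 :=
      Finset.prod_eq_zero (Finset.mem_univ (1 : G)) (by
        rw [AlgEquiv.one_apply, hexp, add_neg_cancel])
    rw [Finset.prod_one_add, Finset.powerset_univ] at hprod
    simp only [← Complex.exp_sum, ← map_sum] at hprod
    rw [← Finset.sum_filter_add_sum_filter_not _ (fun S => b S ≠ 0), add_comm] at hprod
    rw [← hprod]
    congr 1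
    rw [Finset.sum_congr rfl (g := fun _ => (1 : ℂ))]
    · simp [k]
    · intro S hS
      have : b S = 0 := by simpa using (Finset.mem_filter.mp hS).2
      change Complex.exp (φ (b S)) = 1
      rw [this, map_zero, Complex.exp_zero]

open Polynomial in
theorem IsAlgebraic.exists_isGalois_algHom.{u, v} {F : Type u} {L : Type v} [Field F] [CharZero F]
    [Field L] [IsAlgClosed L] [Algebra F L] {θ : L} (hθ : IsAlgebraic F θ) :
    ∃ (K : Type u) (_ : Field K) (_ : Algebra F K), FiniteDimensional F K ∧ IsGalois F K ∧
      ∃ (φ : K →ₐ[F] L) (t : K), φ t = θ := by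
  have hθmem : θ ∈ (minpoly F θ).rootSet L :=
    mem_rootSet.mpr ⟨minpoly.ne_zero hθ.isIntegral, minpoly.aeval _ _⟩
  let φ : (minpoly F θ).SplittingField →ₐ[F] L :=
    SplittingField.lift _ (IsAlgClosed.splits _)
  rw [← (SplittingField.splits (minpoly F θ)).image_rootSet φ] at hθmem
  obtain ⟨t, -, ht⟩ := hθmem
  exact ⟨(minpoly F θ).SplittingField, inferInstance, inferInstance, inferInstance,
    IsGalois.of_separable_splitting_field (minpoly.irreducible hθ.isIntegral).separable,
    φ, t, ht⟩

theorem Complex.exp_ne_neg_one_of_isAlgebraic {θ : ℂ} (hθ : IsAlgebraic ℚ θ) :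
    exp θ ≠ -1 := by
  obtain ⟨K, _, _, _, _, φ, t, rfl⟩ := hθ.exists_isGalois_algHom
  exact IsGalois.exp_algHom_ne_neg_one φ t

theorem Real.transcendental_pi : Transcendental ℚ Real.pi := by
  intro h
  have hpi : IsAlgebraic ℚ (Real.pi : ℂ) := h.algebraMap (A := ℂ)
  have hI : IsAlgebraic ℚ Complex.I := Complex.isIntegral_rat_I.isAlgebraic
  exact Complex.exp_ne_neg_one_of_isAlgebraic (hpi.mul hI) Complex.exp_pi_mul_I

theorem pi_combination_ne_zero (n : ℕ) (α x : Fin n → ℝ)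
    (hα : ∀ i, ∃ p : Polynomial ℚ, α i = Polynomial.aeval Real.pi p)
    (hα0 : ∃ i, α i ≠ 0)
    (hx : ∀ i, IsAlgebraic ℚ (x i))
    (hxli : LinearIndependent ℚ x) :
    ∑ i, α i * x i ≠ 0 := by
  intro hsum
  choose p hp using hα
  let A := algebraicClosure ℚ ℝ
  have : Algebra.IsAlgebraic ℚ A := algebraicClosure.isAlgebraic ℚ ℝ
  let y : Fin n → A := fun i => ⟨x i, mem_algebraicClosure_iff.mpr (hx i)⟩
  have htr : Transcendental A Real.pi := fun h =>
    Real.transcendental_pi (h.restrictScalars ℚ)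
  let P : Polynomial A := ∑ i, Polynomial.C (y i) * (p i).map (algebraMap ℚ A)
  have hP : P = 0 := by
    by_contra hne
    refine htr ⟨P, hne, ?_⟩
    rw [← hsum, map_sum]
    refine Finset.sum_congr rfl fun i _ => ?_
    rw [map_mul, Polynomial.aeval_C, Polynomial.aeval_map_algebraMap, hp i, mul_comm]
    rfl
  obtain ⟨i, hi⟩ := hα0
  refine hi ?_
  have hpi : p i = 0 := by
    ext j
    refine Fintype.linearIndependent_iff.mp hxli (fun i => (p i).coeff j) ?_ i
    have h := congrArg (fun q : Polynomial A => ((q.coeff j : A) : ℝ)) hP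
    simpa [P, y, Polynomial.finsetSum_coeff, Rat.smul_def, mul_comm] using h
  rw [hp i, hpi, map_zero]
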